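/- Let 0 < p < 1. For every κ > 0 there exists a constant C > 0, depending only on A, k, m, n, p and κ, such that for every global weak solution u of the problem and all R > 0 one has (mes(Q_R^κ \ Q_{R/2}^κ))^{−1} ∫_{Q_R^κ \ Q_{R/2}^κ} |u| dx dt + R^{−(m−kκ)} ( (mes(Q_R^κ \ Q_{R/2}^κ))^{−1} ∫_{Q_R^κ \ Q_{R/2}^κ} |u| dx dt )^p ≥ C R^{−(n−(k−1)κ)} ∫_{Q_{R/2}^κ} f(|u|) dx dt. -/

import Mathlib

open MeasureTheory Real Set Filter

noncomputable section

/-- The spatial domain `ℝⁿ`. -/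
abbrev Spc (n : ℕ) := EuclideanSpace ℝ (Fin n)

/-- The open ball `B_r` in `ℝⁿ` of radius `r` centered at `0`. -/
def ball0 (n : ℕ) (r : ℝ) : Set (Spc n) := Metric.ball 0 r

/-- The cylinder `Q_r^κ = B_r × (0, r^κ)`. -/
def cyl (n : ℕ) (r κ : ℝ) : Set (Spc n × ℝ) := ball0 n r ×ˢ Ioo 0 (r ^ κ)

/-- The half-space `ℝ^{n+1}_+ = ℝⁿ × (0, ∞)`. -/
def halfSp (n : ℕ) : Set (Spc n × ℝ) := {z | 0 < z.2}

/-- The (finite) set of multi-indices `α` with `|α| = m`. -/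
def mIdx (n m : ℕ) : Finset (Fin n → ℕ) :=
  (Fintype.piFinset fun _ : Fin n => Finset.range (m + 1)).filter fun α => ∑ i, α i = m

/-- Spatial partial derivative `∂/∂x_i`. -/
def spDeriv (n : ℕ) (i : Fin n) (φ : Spc n × ℝ → ℝ) : Spc n × ℝ → ℝ :=
  fun z => deriv (fun s : ℝ => φ (z.1 + s • EuclideanSpace.single i (1 : ℝ), z.2)) 0

/-- Time derivative `∂/∂t`. -/
def tDeriv (n : ℕ) (φ : Spc n × ℝ → ℝ) : Spc n × ℝ → ℝ :=
  fun z => deriv (fun s : ℝ => φ (z.1, s)) z.2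

/-- Multi-index spatial derivative `∂^α`. -/
def mDeriv (n : ℕ) (α : Fin n → ℕ) (φ : Spc n × ℝ → ℝ) : Spc n × ℝ → ℝ :=
  (List.finRange n).foldr (fun i ψ => (spDeriv n i)^[α i] ψ) φ

/-- Caratheodory conditions and the growth bound `|a_α(x,t,ζ)| ≤ A |ζ|^p` for the
coefficients of the operator `L`. -/
def GoodCoeffs (n m : ℕ) (A p : ℝ) (a : (Fin n → ℕ) → Spc n × ℝ → ℝ → ℝ) : Prop :=
  ∀ α ∈ mIdx n m,
    (∀ ζ : ℝ, Measurable fun z => a α z ζ) ∧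
    (∀ᵐ z ∂(volume.restrict (halfSp n)), Continuous fun ζ => a α z ζ) ∧
    (∀ᵐ z ∂(volume.restrict (halfSp n)), ∀ ζ : ℝ, |a α z ζ| ≤ A * |ζ| ^ p)

/-- The standing conditions on `f`: `ζ ↦ f ζ` and `ζ ↦ f (ζ^{1/p})` are nondecreasing
and convex on `[0,∞)`, and `f` is positive on `(0,∞)`. -/
def GoodF (p : ℝ) (f : ℝ → ℝ) : Prop :=
  MonotoneOn f (Ici 0) ∧ ConvexOn ℝ (Ici 0) f ∧
  MonotoneOn (fun ζ => f (ζ ^ (1 / p))) (Ici 0) ∧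
  ConvexOn ℝ (Ici 0) (fun ζ => f (ζ ^ (1 / p))) ∧
  ∀ ζ : ℝ, 0 < ζ → 0 < f ζ

/-- Condition (1.4): `∫_1^∞ ζ^{1/k - 1} f(ζ)^{-1/k} dζ < ∞`. -/
def Cond14 (k : ℕ) (f : ℝ → ℝ) : Prop :=
  IntegrableOn (fun ζ : ℝ => ζ ^ ((k : ℝ)⁻¹ - 1) / f ζ ^ ((k : ℝ)⁻¹)) (Ioi 1)

/-- Condition (1.5): `∫_1^∞ ζ^{p/m - 1} f(ζ)^{-1/m} dζ < ∞`. -/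
def Cond15 (m : ℕ) (p : ℝ) (f : ℝ → ℝ) : Prop :=
  IntegrableOn (fun ζ : ℝ => ζ ^ (p / (m : ℝ) - 1) / f ζ ^ ((m : ℝ)⁻¹)) (Ioi 1)

/-- `v ∈ L^1_loc(ℝⁿ)`. -/
def L1locInit (n : ℕ) (v : Spc n → ℝ) : Prop :=
  ∀ r : ℝ, 0 < r → IntegrableOn v (ball0 n r)

/-- `u` is a global weak solution of
`∂_t^k u - Σ_{|α| = m} ∂^α a_α(x,t,u) ≥ f(|u|)` in `ℝ^{n+1}_+`, with initial data
`∂_t^i u(·,0) = u0 i` for `0 ≤ i ≤ k-1`. -/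
def IsGlobalWeakSol (n k m : ℕ) (p : ℝ) (a : (Fin n → ℕ) → Spc n × ℝ → ℝ → ℝ)
    (f : ℝ → ℝ) (u0 : ℕ → Spc n → ℝ) (u : Spc n × ℝ → ℝ) : Prop :=
  (∀ r : ℝ, 0 < r → IntegrableOn u (cyl n r 1)) ∧
  (∀ r : ℝ, 0 < r → IntegrableOn (fun z => |u z| ^ p) (cyl n r 1)) ∧
  (∀ r : ℝ, 0 < r → IntegrableOn (fun z => f |u z|) (cyl n r 1)) ∧
  ∀ φ : Spc n × ℝ → ℝ, ContDiff ℝ (⊤ : ℕ∞) φ → HasCompactSupport φ →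
    (∀ z, 0 ≤ φ z) →
    (∫ z in halfSp n, (-1 : ℝ) ^ k * u z * (tDeriv n)^[k] φ z)
      - (∫ z in halfSp n, ∑ α ∈ mIdx n m, (-1 : ℝ) ^ m * a α z (u z) * mDeriv n α φ z)
    ≥ (∫ x : Spc n, ∑ i ∈ Finset.range k,
          (-1 : ℝ) ^ i * u0 (k - 1 - i) x * (tDeriv n)^[i] φ (x, 0))
      + ∫ z in halfSp n, f |u z| * φ z

/-- `u = 0` almost everywhere in `ℝ^{n+1}_+`. -/
def TrivialSol (n : ℕ) (u : Spc n × ℝ → ℝ) : Prop :=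
  ∀ᵐ z ∂(volume.restrict (halfSp n)), u z = 0

/-- The standing hypotheses of Section 3: the coefficients are Caratheodory functions
with the growth bound, `f` satisfies the monotonicity/convexity/positivity conditions
together with (1.4) and (1.5), and the initial data are locally integrable with
`u_{k-1} ≥ 0` a.e. -/
def Standing (n k m : ℕ) (A p : ℝ) (a : (Fin n → ℕ) → Spc n × ℝ → ℝ → ℝ)
    (f : ℝ → ℝ) (u0 : ℕ → Spc n → ℝ) : Prop :=
  GoodCoeffs n m A p a ∧ GoodF p f ∧
  (∀ i < k, L1locInit n (u0 i)) ∧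
  (∀ᵐ x ∂(volume : Measure (Spc n)), 0 ≤ u0 (k - 1) x) ∧
  Cond14 k f ∧ Cond15 m p f

theorem spDeriv_eq_lineDeriv (n : ℕ) (i : Fin n) (φ : Spc n × ℝ → ℝ) :
    spDeriv n i φ = fun z => lineDeriv ℝ φ z (EuclideanSpace.single i 1, 0) := by
  funext z
  simp only [spDeriv, lineDeriv, Prod.smul_mk, smul_zero]
  congr 1
  funext s
  congr 1
  ext <;> simp

theorem tDeriv_eq_lineDeriv (n : ℕ) (φ : Spc n × ℝ → ℝ) :
    tDeriv n φ = fun z => lineDeriv ℝ φ z (0, 1) := by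
  funext z
  have h := deriv_comp_const_add (fun s : ℝ => φ (z.1, s)) z.2 0
  rw [add_zero] at h
  simp only [tDeriv, lineDeriv, ← h]
  congr 1
  funext s
  congr 1
  ext <;> simp

section LineDeriv

variable {E : Type*} [NormedAddCommGroup E] [NormedSpace ℝ E]

theorem lineDeriv_eq_fderiv_of_contDiff {φ : E → ℝ} (h : ContDiff ℝ (⊤ : ℕ∞) φ) (v : E) :
    (fun z => lineDeriv ℝ φ z v) = fun z => fderiv ℝ φ z v :=
  funext fun z => ((h.differentiable (by simp)) z).lineDeriv_eq_fderiv

theorem contDiff_lineDeriv {φ : E → ℝ} (h : ContDiff ℝ (⊤ : ℕ∞) φ) (v : E) :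
    ContDiff ℝ (⊤ : ℕ∞) fun z => lineDeriv ℝ φ z v := by
  rw [lineDeriv_eq_fderiv_of_contDiff h]
  exact (h.fderiv_right (by simp)).clm_apply contDiff_const

theorem hasCompactSupport_lineDeriv {φ : E → ℝ} (h : ContDiff ℝ (⊤ : ℕ∞) φ)
    (hc : HasCompactSupport φ) (v : E) :
    HasCompactSupport fun z => lineDeriv ℝ φ z v := by
  rw [lineDeriv_eq_fderiv_of_contDiff h]
  exact hc.fderiv_apply ℝ v

theorem eventually_lineDeriv_eq_zero {φ : E → ℝ} {z : E} {c : ℝ} (h : ∀ᶠ w in nhds z, φ w = c)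
    (v : E) : ∀ᶠ w in nhds z, lineDeriv ℝ φ w v = 0 := by
  filter_upwards [h.eventually_nhds] with w hw
  have : φ =ᶠ[nhds w] fun _ => c := hw
  rw [this.lineDeriv_eq]
  simp [lineDeriv]

theorem lineDeriv_const_mul_comp_linear (Φ : E → ℝ) (L : E →L[ℝ] E) (c r : ℝ) (z v : E)
    (hv : L v = r • v) :
    lineDeriv ℝ (fun w => c * Φ (L w)) z v = c * r * lineDeriv ℝ Φ (L z) v := by
  have h : lineDeriv ℝ (fun w => c * Φ (L w)) z v = c * lineDeriv ℝ Φ (L z) (L v) := by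
    simp only [lineDeriv, map_add, map_smul]
    exact deriv_const_mul_field c
  rw [h, hv, lineDeriv_smul, smul_eq_mul, mul_assoc]

end LineDeriv

/-- Transfer of a graded relation through the multi-index derivative `∂^α`. -/
theorem mDeriv_induction {n : ℕ} {Rel : ℕ → (Spc n × ℝ → ℝ) → (Spc n × ℝ → ℝ) → Prop}
    (step : ∀ i j Φ φ, Rel j Φ φ → Rel (j + 1) (spDeriv n i Φ) (spDeriv n i φ))
    (α : Fin n → ℕ) {Φ φ : Spc n × ℝ → ℝ} (h : Rel 0 Φ φ) :
    Rel (∑ i, α i) (mDeriv n α Φ) (mDeriv n α φ) := by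
  have iter : ∀ (i : Fin n) (q j : ℕ) (Φ φ : Spc n × ℝ → ℝ), Rel j Φ φ →
      Rel (q + j) ((spDeriv n i)^[q] Φ) ((spDeriv n i)^[q] φ) := by
    intro i q j Φ φ hj
    induction q with
    | zero => simpa using hj
    | succ q ih =>
      rw [Function.iterate_succ_apply', Function.iterate_succ_apply', Nat.succ_add]
      exact step _ _ _ _ ih
  rw [← List.sum_ofFn, List.ofFn_eq_map]
  unfold mDeriv
  induction List.finRange n with
  | nil => simpa using h
  | cons i l ih => simpa using iter i (α i) _ _ _ ih

/-- Transfer of a graded relation through iterated time derivatives. -/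
theorem tDeriv_iterate_induction {n : ℕ}
    {Rel : ℕ → (Spc n × ℝ → ℝ) → (Spc n × ℝ → ℝ) → Prop}
    (step : ∀ j Φ φ, Rel j Φ φ → Rel (j + 1) (tDeriv n Φ) (tDeriv n φ))
    (q : ℕ) {Φ φ : Spc n × ℝ → ℝ} (h : Rel 0 Φ φ) :
    Rel q ((tDeriv n)^[q] Φ) ((tDeriv n)^[q] φ) := by
  induction q with
  | zero => exact h
  | succ q ih =>
    rw [Function.iterate_succ_apply', Function.iterate_succ_apply']
    exact step _ _ _ ih

theorem exists_bound_mDeriv {n : ℕ} {Φ : Spc n × ℝ → ℝ} (h : ContDiff ℝ (⊤ : ℕ∞) Φ)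
    (hc : HasCompactSupport Φ) (α : Fin n → ℕ) : ∃ M, ∀ z, |mDeriv n α Φ z| ≤ M := by
  have key := mDeriv_induction (n := n)
    (Rel := fun _ φ _ => ContDiff ℝ (⊤ : ℕ∞) φ ∧ HasCompactSupport φ)
    (fun i j φ _ hφ => by
      rw [spDeriv_eq_lineDeriv]
      exact ⟨contDiff_lineDeriv hφ.1 _, hasCompactSupport_lineDeriv hφ.1 hφ.2 _⟩)
    α (Φ := Φ) (φ := Φ) ⟨h, hc⟩
  exact key.1.continuous.bounded_above_of_compact_support key.2

theorem exists_bound_tDeriv_iterate {n : ℕ} {Φ : Spc n × ℝ → ℝ} (h : ContDiff ℝ (⊤ : ℕ∞) Φ)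
    (hc : HasCompactSupport Φ) (q : ℕ) : ∃ M, ∀ z, |(tDeriv n)^[q] Φ z| ≤ M := by
  have key := tDeriv_iterate_induction (n := n)
    (Rel := fun _ φ _ => ContDiff ℝ (⊤ : ℕ∞) φ ∧ HasCompactSupport φ)
    (fun j φ _ hφ => by
      rw [tDeriv_eq_lineDeriv]
      exact ⟨contDiff_lineDeriv hφ.1 _, hasCompactSupport_lineDeriv hφ.1 hφ.2 _⟩)
    q (Φ := Φ) (φ := Φ) ⟨h, hc⟩
  exact key.1.continuous.bounded_above_of_compact_support key.2

theorem mDeriv_eq_zero {n : ℕ} {φ : Spc n × ℝ → ℝ} {z : Spc n × ℝ} {c : ℝ}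
    (h : ∀ᶠ w in nhds z, φ w = c) {α : Fin n → ℕ} (hα : ∑ i, α i ≠ 0) :
    mDeriv n α φ z = 0 := by
  have key := mDeriv_induction (n := n)
    (Rel := fun j φ _ => ∀ᶠ w in nhds z, φ w = if j = 0 then c else 0)
    (fun i j φ _ hφ => by
      rw [spDeriv_eq_lineDeriv]
      simpa using eventually_lineDeriv_eq_zero hφ _)
    α (Φ := φ) (φ := φ) (by simpa using h)
  simpa [hα] using key.self_of_nhds

theorem tDeriv_iterate_eq_zero {n : ℕ} {φ : Spc n × ℝ → ℝ} {z : Spc n × ℝ} {c : ℝ}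
    (h : ∀ᶠ s in nhds z.2, φ (z.1, s) = c) {q : ℕ} (hq : q ≠ 0) :
    (tDeriv n)^[q] φ z = 0 := by
  have key := tDeriv_iterate_induction (n := n)
    (Rel := fun j φ _ => ∀ᶠ s in nhds z.2, φ (z.1, s) = if j = 0 then c else 0)
    (fun j φ _ hφ => by
      filter_upwards [hφ.eventually_nhds] with s hs
      have hs' : (fun s => φ (z.1, s)) =ᶠ[nhds s] fun _ => if j = 0 then c else 0 := hs
      simp [tDeriv, hs'.deriv_eq])
    q (Φ := φ) (φ := φ) (by simpa using h)
  simpa [hq] using key.self_of_nhds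

/-- The anisotropic dilation `(x, t) ↦ (x / R, t / T)`. -/
def dilate (n : ℕ) (R T : ℝ) : (Spc n × ℝ) →L[ℝ] (Spc n × ℝ) :=
  (R⁻¹ • ContinuousLinearMap.id ℝ (Spc n)).prodMap (T⁻¹ • ContinuousLinearMap.id ℝ ℝ)

theorem dilate_apply (n : ℕ) (R T : ℝ) (z : Spc n × ℝ) :
    dilate n R T z = (R⁻¹ • z.1, T⁻¹ * z.2) := rfl

theorem mDeriv_comp_dilate {n : ℕ} (Φ : Spc n × ℝ → ℝ) (R T : ℝ) (α : Fin n → ℕ)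
    (z : Spc n × ℝ) :
    mDeriv n α (fun w => Φ (dilate n R T w)) z
      = R⁻¹ ^ (∑ i, α i) * mDeriv n α Φ (dilate n R T z) := by
  refine congrFun (mDeriv_induction (n := n)
    (Rel := fun j Ψ ψ => ψ = fun w => R⁻¹ ^ j * Ψ (dilate n R T w)) ?_
    α (Φ := Φ) (φ := fun w => Φ (dilate n R T w)) (by simp)) z
  rintro i j Ψ ψ rfl
  funext w
  rw [spDeriv_eq_lineDeriv, spDeriv_eq_lineDeriv,
    pow_succ]
  exact lineDeriv_const_mul_comp_linear Ψ (dilate n R T) _ R⁻¹ w _ (by simp [dilate_apply])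

theorem tDeriv_iterate_comp_dilate {n : ℕ} (Φ : Spc n × ℝ → ℝ) (R T : ℝ) (q : ℕ)
    (z : Spc n × ℝ) :
    (tDeriv n)^[q] (fun w => Φ (dilate n R T w)) z
      = T⁻¹ ^ q * (tDeriv n)^[q] Φ (dilate n R T z) := by
  refine congrFun (tDeriv_iterate_induction (n := n)
    (Rel := fun j Ψ ψ => ψ = fun w => T⁻¹ ^ j * Ψ (dilate n R T w)) ?_
    q (Φ := Φ) (φ := fun w => Φ (dilate n R T w)) (by simp)) z
  rintro j Ψ ψ rfl
  funext w
  rw [tDeriv_eq_lineDeriv, tDeriv_eq_lineDeriv,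
    pow_succ]
  exact lineDeriv_const_mul_comp_linear Ψ (dilate n R T) _ T⁻¹ w _ (by simp [dilate_apply])

/-- A smooth cutoff, equal to `1` on a neighbourhood of the closure of `B_{1/2} × (-ρ, ρ)` and
supported inside `B_1 × (-1, 1)`. -/
theorem exists_cutoff (n : ℕ) {ρ : ℝ} (hρ0 : 0 < ρ) (hρ1 : ρ < 1) :
    ∃ Φ : Spc n × ℝ → ℝ, ContDiff ℝ (⊤ : ℕ∞) Φ ∧ HasCompactSupport Φ ∧ (∀ z, 0 ≤ Φ z) ∧
      (∀ z, Φ z ≤ 1) ∧ (∀ z, ‖z.1‖ ≤ 1 / 2 → |z.2| ≤ ρ → Φ z = 1) ∧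
      (∀ x t, |t| ≤ ρ → Φ (x, t) = Φ (x, 0)) ∧
      ∃ r < 1, ∀ z, r < ‖z.1‖ ∨ r < |z.2| → Φ z = 0 := by
  obtain ⟨r, hr, hr1⟩ := exists_between (max_lt (by norm_num : (1 / 2 : ℝ) < 1) hρ1)
  rw [max_lt_iff] at hr
  let g : ContDiffBump (0 : Spc n) := ⟨1 / 2, r, by norm_num, hr.1⟩
  let h : ContDiffBump (0 : ℝ) := ⟨ρ, r, hρ0, hr.2⟩
  have hg0 : ∀ x : Spc n, r < ‖x‖ → g x = 0 := fun x hx =>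
    g.zero_of_le_dist (by simpa using hx.le)
  have hh0 : ∀ t : ℝ, r < |t| → h t = 0 := fun t ht =>
    h.zero_of_le_dist (by simpa using ht.le)
  have hh1 : ∀ t : ℝ, |t| ≤ ρ → h t = 1 := fun t ht =>
    h.one_of_mem_closedBall (by simpa using ht)
  have hzero : ∀ z : Spc n × ℝ, r < ‖z.1‖ ∨ r < |z.2| → g z.1 * h z.2 = 0 := by
    rintro z (hz | hz)
    · rw [hg0 _ hz, zero_mul]
    · rw [hh0 _ hz, mul_zero]
  refine ⟨fun z => g z.1 * h z.2,
    (g.contDiff.comp contDiff_fst).mul (h.contDiff.comp contDiff_snd), ?_,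
    fun z => mul_nonneg g.nonneg h.nonneg, fun z => mul_le_one₀ g.le_one h.nonneg h.le_one,
    fun z hz1 hz2 => ?_, fun x t ht => ?_, r, hr1, hzero⟩
  · refine HasCompactSupport.intro
      ((isCompact_closedBall (0 : Spc n) r).prod (isCompact_closedBall (0 : ℝ) r)) fun z hz => ?_
    refine hzero z ?_
    by_contra! hcon
    exact hz ⟨by simpa using hcon.1, by simpa using hcon.2⟩
  · have : g z.1 = 1 := g.one_of_mem_closedBall (by simpa [g] using hz1)
    simp [this, hh1 _ hz2]
  · simp [hh1 t ht, hh1 0 (by simpa using hρ0.le)]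

theorem measurableSet_cyl (n : ℕ) (r κ : ℝ) : MeasurableSet (cyl n r κ) :=
  Metric.isOpen_ball.measurableSet.prod measurableSet_Ioo

theorem isOpen_cyl (n : ℕ) (r κ : ℝ) : IsOpen (cyl n r κ) :=
  Metric.isOpen_ball.prod isOpen_Ioo

theorem measurableSet_halfSp (n : ℕ) : MeasurableSet (halfSp n) :=
  measurableSet_lt measurable_const measurable_snd

theorem cyl_subset_halfSp (n : ℕ) (r κ : ℝ) : cyl n r κ ⊆ halfSp n := fun _ hz => hz.2.1

theorem cyl_mono {n : ℕ} {r s κ : ℝ} (hr : 0 ≤ r) (hκ : 0 ≤ κ) (h : r ≤ s) :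
    cyl n r κ ⊆ cyl n s κ :=
  Set.prod_mono (Metric.ball_subset_ball h) (Ioo_subset_Ioo_right (rpow_le_rpow hr h hκ))

theorem cyl_subset_cyl_one (n : ℕ) (r κ : ℝ) : cyl n r κ ⊆ cyl n (max r (r ^ κ)) 1 :=
  Set.prod_mono (Metric.ball_subset_ball (le_max_left _ _))
    (Ioo_subset_Ioo_right (by rw [rpow_one]; exact le_max_right _ _))

theorem integrableOn_cyl {n : ℕ} {g : Spc n × ℝ → ℝ}
    (h : ∀ r : ℝ, 0 < r → IntegrableOn g (cyl n r 1)) {r : ℝ} (hr : 0 < r) (κ : ℝ) :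
    IntegrableOn g (cyl n r κ) :=
  (h _ (lt_max_of_lt_left hr)).mono_set (cyl_subset_cyl_one n r κ)

theorem volume_cyl (n : ℕ) {r : ℝ} (hr : 0 < r) (κ : ℝ) :
    volume (cyl n r κ)
      = ENNReal.ofReal (r ^ n) * volume (Metric.ball (0 : Spc n) 1) * ENNReal.ofReal (r ^ κ) := by
  have h := Measure.addHaar_ball_mul_of_pos (volume : Measure (Spc n)) 0 hr 1
  rw [mul_one, finrank_euclideanSpace, Fintype.card_fin] at h
  rw [cyl, ball0, Measure.volume_eq_prod, Measure.prod_prod, h, Real.volume_Ioo, sub_zero]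

theorem volume_real_cyl (n : ℕ) {r : ℝ} (hr : 0 < r) (κ : ℝ) :
    volume.real (cyl n r κ) = r ^ n * volume.real (Metric.ball (0 : Spc n) 1) * r ^ κ := by
  rw [measureReal_def, volume_cyl n hr, ENNReal.toReal_mul, ENNReal.toReal_mul,
    ENNReal.toReal_ofReal (by positivity), ENNReal.toReal_ofReal (by positivity), measureReal_def]

theorem volume_cyl_ne_top (n : ℕ) {r : ℝ} (hr : 0 < r) (κ : ℝ) : volume (cyl n r κ) ≠ ⊤ := by
  rw [volume_cyl n hr]
  exact ENNReal.mul_ne_top (ENNReal.mul_ne_top ENNReal.ofReal_ne_top measure_ball_lt_top.ne)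
    ENNReal.ofReal_ne_top

theorem GoodF.nonneg {p : ℝ} {f : ℝ → ℝ} (h : GoodF p f) {ζ : ℝ} (hζ : 0 ≤ ζ) : 0 ≤ f ζ := by
  obtain ⟨-, hconv, -, -, hpos⟩ := h
  rcases hζ.eq_or_lt with rfl | hlt
  · by_contra! hneg
    have h1 := hpos 1 one_pos
    have hd : 0 < f 1 - f 0 := by linarith
    have hlt : 0 < -f 0 / (f 1 - f 0) := div_pos (by linarith) hd
    have hc := hconv.2 (mem_Ici.2 le_rfl) (mem_Ici.2 zero_le_one)
      (by rw [sub_nonneg, div_le_one hd]; linarith :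
        0 ≤ 1 - -f 0 / (f 1 - f 0)) hlt.le (by ring)
    have hp := hpos _ hlt
    simp only [smul_eq_mul, mul_zero, mul_one, zero_add] at hc
    have : (1 - -f 0 / (f 1 - f 0)) * f 0 + -f 0 / (f 1 - f 0) * f 1 = 0 := by
      field_simp
      ring
    linarith
  · exact (hpos ζ hlt).le

theorem setIntegral_rpow_le {α : Type*} [MeasurableSpace α] {μ : Measure α} {S : Set α}
    (hS : μ S ≠ ⊤) {p : ℝ} (hp0 : 0 ≤ p) (hp1 : p ≤ 1) {g : α → ℝ} (hg0 : ∀ x, 0 ≤ g x)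
    (hg : IntegrableOn g S μ) (hgp : IntegrableOn (fun x => g x ^ p) S μ) :
    ∫ x in S, g x ^ p ∂μ ≤ μ.real S * ((μ.real S)⁻¹ * ∫ x in S, g x ∂μ) ^ p := by
  by_cases h0 : μ S = 0
  · simp [Measure.restrict_eq_zero.2 h0, measureReal_def, h0]
  have hpos : 0 < μ.real S := ENNReal.toReal_pos h0 hS
  have h := (Real.concaveOn_rpow hp0 hp1).le_map_set_average
    (Real.continuous_rpow_const hp0).continuousOn isClosed_Ici h0 hS
    (Eventually.of_forall fun x => hg0 x) hg hgp
  rw [setAverage_eq, setAverage_eq, smul_eq_mul, smul_eq_mul] at h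
  rwa [inv_mul_le_iff₀ hpos] at h

/-- The energy estimate obtained by testing the inequality with a dilated cutoff. -/
theorem exists_setIntegral_source_le (n k m : ℕ) (hk : 1 ≤ k) (hm : 1 ≤ m)
    (A p : ℝ) (hA : 0 < A) (κ : ℝ) (hκ : 0 < κ) :
    ∃ K : ℝ, 0 < K ∧
      ∀ (a : (Fin n → ℕ) → Spc n × ℝ → ℝ → ℝ) (f : ℝ → ℝ) (u0 : ℕ → Spc n → ℝ)
        (u : Spc n × ℝ → ℝ), Standing n k m A p a f u0 →
        IsGlobalWeakSol n k m p a f u0 u →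
        ∀ R : ℝ, 0 < R →
          ∫ z in cyl n (R / 2) κ, f |u z| ≤
            K * ((R ^ κ)⁻¹ ^ k * ∫ z in cyl n R κ \ cyl n (R / 2) κ, |u z|)
              + K * (R⁻¹ ^ m * ∫ z in cyl n R κ \ cyl n (R / 2) κ, |u z| ^ p) := by
  set ρ : ℝ := (1 / 2) ^ κ with hρ
  have hρ0 : 0 < ρ := by positivity
  have hρ1 : ρ < 1 := rpow_lt_one (by norm_num) (by norm_num) hκ
  obtain ⟨Φ, hΦs, hΦc, hΦ0, hΦ1, hΦone, hΦt, r, hr1, hΦzero⟩ := exists_cutoff n hρ0 hρ1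
  obtain ⟨M₁, hM₁⟩ := exists_bound_tDeriv_iterate hΦs hΦc k
  choose M₂ hM₂ using exists_bound_mDeriv hΦs hΦc
  have hM₁0 : 0 ≤ M₁ := (abs_nonneg _).trans (hM₁ 0)
  have hM₂0 : ∀ α, 0 ≤ M₂ α := fun α => (abs_nonneg _).trans (hM₂ α 0)
  have hsum0 : 0 ≤ ∑ α ∈ mIdx n m, M₂ α := Finset.sum_nonneg fun α _ => hM₂0 α
  refine ⟨M₁ + A * ∑ α ∈ mIdx n m, M₂ α + 1, by positivity, ?_⟩
  rintro a f u0 u ⟨hcoef, hf, -, hu0, -, -⟩ ⟨hu, hup, hfu, hsol⟩ R hR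
  set T : ℝ := R ^ κ with hT
  have hT0 : 0 < T := by positivity
  have hhalf : (R / 2) ^ κ = ρ * T := by
    rw [hρ, hT, ← mul_rpow (by norm_num) hR.le]
    congr 1
    ring
  set S : Set (Spc n × ℝ) := cyl n R κ \ cyl n (R / 2) κ with hS
  have hSm : MeasurableSet S := (measurableSet_cyl n R κ).diff (measurableSet_cyl n (R / 2) κ)
  set φ : Spc n × ℝ → ℝ := fun z => Φ (dilate n R T z) with hφ
  have hnorm1 : ∀ z : Spc n × ℝ, ‖(dilate n R T z).1‖ = ‖z.1‖ / R := fun z => by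
    rw [dilate_apply, norm_smul, norm_inv, Real.norm_of_nonneg hR.le, inv_mul_eq_div]
  have hnorm2 : ∀ z : Spc n × ℝ, |(dilate n R T z).2| = |z.2| / T := fun z => by
    rw [dilate_apply, abs_mul, abs_inv, abs_of_pos hT0, inv_mul_eq_div]
  have hφs : ContDiff ℝ (⊤ : ℕ∞) φ := hΦs.comp (dilate n R T).contDiff
  have hφ0 : ∀ z, 0 ≤ φ z := fun z => hΦ0 _
  have hφ1 : ∀ z, φ z ≤ 1 := fun z => hΦ1 _
  have hφone : ∀ z ∈ cyl n (R / 2) κ, φ z = 1 := by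
    rintro z ⟨hz1, hz2, hz3⟩
    rw [ball0, mem_ball_zero_iff] at hz1
    rw [hhalf] at hz3
    refine hΦone _ ?_ ?_
    · rw [hnorm1, div_le_iff₀ hR]
      linarith
    · rw [hnorm2, div_le_iff₀ hT0, abs_of_pos hz2]
      exact hz3.le
  have hφzero : ∀ z : Spc n × ℝ, R * r < ‖z.1‖ ∨ T * r < |z.2| → φ z = 0 := by
    intro z hz
    refine hΦzero _ ?_
    rw [hnorm1, hnorm2, lt_div_iff₀ hR, lt_div_iff₀ hT0, mul_comm r, mul_comm r]
    exact hz
  have hφc : HasCompactSupport φ := by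
    refine HasCompactSupport.intro
      ((isCompact_closedBall (0 : Spc n) (R * r)).prod (isCompact_closedBall (0 : ℝ) (T * r)))
      fun z hz => hφzero z ?_
    by_contra! hcon
    exact hz ⟨by simpa using hcon.1, by simpa using hcon.2⟩
  have hout : ∀ z ∈ halfSp n, z ∉ cyl n R κ → ∀ᶠ w in nhds z, φ w = 0 := by
    intro z hz hzR
    have hor : R * r < ‖z.1‖ ∨ T * r < |z.2| := by
      by_contra! hcon
      refine hzR ⟨?_, hz, ?_⟩
      · rw [ball0, mem_ball_zero_iff]
        nlinarith [hcon.1]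
      · nlinarith [hcon.2, le_abs_self z.2]
    rcases hor with h | h
    · filter_upwards [(continuous_fst.norm.tendsto z).eventually_const_lt h] with w hw
      exact hφzero w (Or.inl hw)
    · filter_upwards [(continuous_snd.abs.tendsto z).eventually_const_lt h] with w hw
      exact hφzero w (Or.inr hw)
  have hloc : ∀ z ∈ halfSp n, z ∉ S → ∃ c, ∀ᶠ w in nhds z, φ w = c := by
    intro z hz hzS
    by_cases hzR : z ∈ cyl n R κ
    · have hz2 : z ∈ cyl n (R / 2) κ := by
        by_contra hcon
        exact hzS ⟨hzR, hcon⟩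
      exact ⟨1, Filter.eventually_of_mem ((isOpen_cyl n _ κ).mem_nhds hz2) hφone⟩
    · exact ⟨0, hout z hz hzR⟩
  have hSsub : S ⊆ cyl n R κ := sdiff_subset
  have hShalf : S ⊆ halfSp n := hSsub.trans (cyl_subset_halfSp n R κ)
  have huS : IntegrableOn (fun z => |u z|) S :=
    ((integrableOn_cyl hu hR κ).mono_set hSsub).abs
  have hupS : IntegrableOn (fun z => |u z| ^ p) S := (integrableOn_cyl hup hR κ).mono_set hSsub
  have bound : ∀ (F g : Spc n × ℝ → ℝ), IntegrableOn g S →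
      (∀ᵐ z ∂volume.restrict (halfSp n), |F z| ≤ S.indicator g z) →
      |∫ z in halfSp n, F z| ≤ ∫ z in S, g z := by
    intro F g hg h
    have hi : Integrable (S.indicator g) (volume.restrict (halfSp n)) :=
      ((integrable_indicator_iff hSm).2 hg).integrableOn
    refine (norm_integral_le_of_norm_le (f := F) hi h).trans_eq ?_
    rw [integral_indicator hSm, Measure.restrict_restrict hSm, inter_eq_left.2 hShalf]
  have hI₁ : |∫ z in halfSp n, (-1 : ℝ) ^ k * u z * (tDeriv n)^[k] φ z|
      ≤ ∫ z in S, M₁ * T⁻¹ ^ k * |u z| := by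
    refine bound _ _ (huS.const_mul _) ?_
    filter_upwards [ae_restrict_mem (measurableSet_halfSp n)] with z hz
    by_cases hzS : z ∈ S
    · rw [indicator_of_mem hzS, abs_mul, abs_mul, abs_pow, abs_neg, abs_one, one_pow, one_mul,
        tDeriv_iterate_comp_dilate, abs_mul, abs_of_nonneg (by positivity : 0 ≤ T⁻¹ ^ k)]
      calc |u z| * (T⁻¹ ^ k * |(tDeriv n)^[k] Φ (dilate n R T z)|)
          ≤ |u z| * (T⁻¹ ^ k * M₁) := by gcongr; exact hM₁ _
        _ = M₁ * T⁻¹ ^ k * |u z| := by ring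
    · obtain ⟨c, hc⟩ := hloc z hz hzS
      have hc' : ∀ᶠ s in nhds z.2, φ (z.1, s) = c :=
        ((Continuous.prodMk_right z.1).tendsto z.2).eventually hc
      rw [indicator_of_notMem hzS, tDeriv_iterate_eq_zero hc' (by omega), mul_zero, abs_zero]
  have hI₂ : |∫ z in halfSp n,
        ∑ α ∈ mIdx n m, (-1 : ℝ) ^ m * a α z (u z) * mDeriv n α φ z|
      ≤ ∫ z in S, A * (∑ α ∈ mIdx n m, M₂ α) * R⁻¹ ^ m * |u z| ^ p := by
    refine bound _ _ (hupS.const_mul _) ?_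
    have hgrow : ∀ᵐ z ∂volume.restrict (halfSp n), ∀ α ∈ mIdx n m,
        |a α z (u z)| ≤ A * |u z| ^ p := by
      rw [Finset.eventually_all]
      intro α hα
      filter_upwards [(hcoef α hα).2.2] with z hz using hz _
    filter_upwards [ae_restrict_mem (measurableSet_halfSp n), hgrow] with z hz hza
    have hdeg : ∀ α ∈ mIdx n m, ∑ i, α i = m := fun α hα => (Finset.mem_filter.1 hα).2
    by_cases hzS : z ∈ S
    · rw [indicator_of_mem hzS]
      refine (Finset.abs_sum_le_sum_abs _ _).trans ?_
      rw [Finset.mul_sum, Finset.sum_mul, Finset.sum_mul]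
      refine Finset.sum_le_sum fun α hα => ?_
      rw [abs_mul, abs_mul, abs_pow, abs_neg, abs_one, one_pow, one_mul,
        mDeriv_comp_dilate, hdeg α hα, abs_mul, abs_of_nonneg (by positivity : 0 ≤ R⁻¹ ^ m)]
      calc |a α z (u z)| * (R⁻¹ ^ m * |mDeriv n α Φ (dilate n R T z)|)
          ≤ (A * |u z| ^ p) * (R⁻¹ ^ m * M₂ α) := by
            gcongr
            · exact hza α hα
            · exact hM₂ α _
        _ = A * M₂ α * R⁻¹ ^ m * |u z| ^ p := by ring
    · obtain ⟨c, hc⟩ := hloc z hz hzS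
      rw [indicator_of_notMem hzS, Finset.sum_eq_zero fun α hα => ?_, abs_zero]
      rw [mDeriv_eq_zero hc (by rw [hdeg α hα]; omega), mul_zero]
  have hinit : 0 ≤ ∫ x : Spc n, ∑ i ∈ Finset.range k,
      (-1 : ℝ) ^ i * u0 (k - 1 - i) x * (tDeriv n)^[i] φ (x, 0) := by
    refine integral_nonneg_of_ae ?_
    filter_upwards [hu0] with x hx
    have hc : ∀ᶠ t in nhds (0 : ℝ), φ (x, t) = φ (x, 0) := by
      filter_upwards [Metric.closedBall_mem_nhds (0 : ℝ) (mul_pos hρ0 hT0)] with t ht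
      have h2 := hnorm2 (x, t)
      simp only [hφ, dilate_apply, mul_zero] at h2 ⊢
      refine hΦt _ _ ?_
      rw [h2, div_le_iff₀ hT0]
      simpa using ht
    rw [Pi.zero_apply, Finset.sum_eq_single_of_mem 0 (Finset.mem_range.2 hk) fun i _ hi => by
      rw [tDeriv_iterate_eq_zero (z := (x, 0)) hc hi, mul_zero]]
    simpa using mul_nonneg hx (hφ0 (x, 0))
  have hsource : ∫ z in cyl n (R / 2) κ, f |u z| ≤ ∫ z in halfSp n, f |u z| * φ z := by
    rw [setIntegral_eq_of_subset_of_forall_sdiff_eq_zero (measurableSet_halfSp n)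
      (cyl_subset_halfSp n R κ) fun z hz => by
        rw [(hout z hz.1 hz.2).self_of_nhds, mul_zero]]
    calc ∫ z in cyl n (R / 2) κ, f |u z|
        = ∫ z in cyl n (R / 2) κ, f |u z| * φ z :=
          setIntegral_congr_fun (measurableSet_cyl n _ κ) fun z hz => by
            simp only [hφone z hz, mul_one]
      _ ≤ ∫ z in cyl n R κ, f |u z| * φ z := by
          refine setIntegral_mono_set ?_
            (Eventually.of_forall fun z => mul_nonneg (hf.nonneg (abs_nonneg _)) (hφ0 z))
            (cyl_mono (by linarith) hκ.le (by linarith)).eventuallyLE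
          refine (integrableOn_cyl hfu hR κ).mul_bdd (c := 1)
            hφs.continuous.aestronglyMeasurable (Eventually.of_forall fun z => ?_)
          rw [Real.norm_of_nonneg (hφ0 z)]
          exact hφ1 z
  have hmain := hsol φ hφs hφc hφ0
  rw [integral_const_mul] at hI₁ hI₂
  have hX : 0 ≤ T⁻¹ ^ k * ∫ z in S, |u z| :=
    mul_nonneg (by positivity) (integral_nonneg fun z => abs_nonneg _)
  have hY : 0 ≤ R⁻¹ ^ m * ∫ z in S, |u z| ^ p :=
    mul_nonneg (by positivity) (integral_nonneg fun z => rpow_nonneg (abs_nonneg _) _)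
  have h₁ := (abs_le.1 hI₁).2
  have h₂ := (abs_le.1 hI₂).1
  rw [mul_assoc] at h₁ h₂
  have hAM : 0 ≤ A * ∑ α ∈ mIdx n m, M₂ α := by positivity
  nlinarith [mul_nonneg hM₁0 hY, mul_nonneg hAM hX]

/-- **Lemma 3.7.** Let `0 < p < 1`. For every `κ > 0` there is `C > 0`, depending only
on `A, k, m, n, p, κ`, such that for every global weak solution `u` and all `R > 0`,
`avg |u| + R^{-(m-kκ)} (avg |u|)^p ≥ C R^{-(n-(k-1)κ)} ∫_{Q_{R/2}^κ} f(|u|)`,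
where the averages are over `Q_R^κ \ Q_{R/2}^κ`. -/
theorem lemma_3_7
    (n k m : ℕ) (hn : 1 ≤ n) (hk : 1 ≤ k) (hm : 1 ≤ m)
    (A p : ℝ) (hA : 0 < A) (hp0 : 0 < p) (hp1 : p < 1) (κ : ℝ) (hκ : 0 < κ) :
    ∃ C : ℝ, 0 < C ∧
      ∀ (a : (Fin n → ℕ) → Spc n × ℝ → ℝ → ℝ) (f : ℝ → ℝ) (u0 : ℕ → Spc n → ℝ)
        (u : Spc n × ℝ → ℝ), Standing n k m A p a f u0 →
        IsGlobalWeakSol n k m p a f u0 u →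
        ∀ R : ℝ, 0 < R → ∀ v : ℝ,
          v = (volume (cyl n R κ \ cyl n (R / 2) κ)).toReal⁻¹
              * ∫ z in cyl n R κ \ cyl n (R / 2) κ, |u z| →
          C * (R ^ (-((n : ℝ) - ((k : ℝ) - 1) * κ)) * ∫ z in cyl n (R / 2) κ, f |u z|) ≤
            v + R ^ (-((m : ℝ) - (k : ℝ) * κ)) * v ^ p := by
  obtain ⟨K, hK, hest⟩ := exists_setIntegral_source_le n k m hk hm A p hA κ hκ
  set ω : ℝ := volume.real (Metric.ball (0 : Spc n) 1) with hω
  have hω0 : 0 < ω :=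
    ENNReal.toReal_pos (Metric.measure_ball_pos volume _ one_pos).ne' measure_ball_lt_top.ne
  refine ⟨(K * ω)⁻¹, by positivity, ?_⟩
  intro a f u0 u hst hsol R hR v hv
  set S : Set (Spc n × ℝ) := cyl n R κ \ cyl n (R / 2) κ with hS
  have hvol : volume S ≠ ⊤ := measure_ne_top_of_subset sdiff_subset (volume_cyl_ne_top n hR κ)
  have hVle : volume.real S ≤ R ^ n * ω * R ^ κ := by
    rw [← volume_real_cyl n hR κ]
    exact measureReal_mono sdiff_subset (volume_cyl_ne_top n hR κ)
  have huS : IntegrableOn (fun z => |u z|) S :=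
    ((integrableOn_cyl hsol.1 hR κ).mono_set sdiff_subset).abs
  have hupS : IntegrableOn (fun z => |u z| ^ p) S :=
    (integrableOn_cyl hsol.2.1 hR κ).mono_set sdiff_subset
  have hv0 : 0 ≤ v := by
    rw [hv]
    exact mul_nonneg (by positivity) (integral_nonneg fun z => abs_nonneg _)
  have hJ₁ : ∫ z in S, |u z| ≤ R ^ n * ω * R ^ κ * v := by
    have h := setIntegral_rpow_le hvol zero_le_one le_rfl (fun z => abs_nonneg (u z)) huS
      (by simpa using huS)
    simp only [rpow_one] at h
    rw [measureReal_def, ← hv] at h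
    exact h.trans (mul_le_mul_of_nonneg_right hVle hv0)
  have hJ₂ : ∫ z in S, |u z| ^ p ≤ R ^ n * ω * R ^ κ * v ^ p := by
    have h := setIntegral_rpow_le hvol hp0.le hp1.le (fun z => abs_nonneg (u z)) huS hupS
    rw [measureReal_def, ← hv] at h
    exact h.trans (mul_le_mul_of_nonneg_right hVle (rpow_nonneg hv0 p))
  have hRn : R ^ (-((n : ℝ) - ((k : ℝ) - 1) * κ)) = (R ^ n)⁻¹ * ((R ^ κ) ^ k * (R ^ κ)⁻¹) := by
    rw [← rpow_natCast R n, ← rpow_mul_natCast hR.le, ← rpow_neg hR.le, ← rpow_neg hR.le,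
      ← rpow_add hR, ← rpow_add hR]
    congr 1
    ring
  have hRm : R ^ (-((m : ℝ) - (k : ℝ) * κ)) = R⁻¹ ^ m * (R ^ κ) ^ k := by
    rw [inv_pow, ← rpow_natCast R m, ← rpow_mul_natCast hR.le, ← rpow_neg hR.le, ← rpow_add hR]
    congr 1
    ring
  rw [hRn, hRm]
  have hT : 0 < R ^ κ := by positivity
  calc (K * ω)⁻¹ * ((R ^ n)⁻¹ * ((R ^ κ) ^ k * (R ^ κ)⁻¹) * ∫ z in cyl n (R / 2) κ, f |u z|)
      ≤ (K * ω)⁻¹ * ((R ^ n)⁻¹ * ((R ^ κ) ^ k * (R ^ κ)⁻¹)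
          * (K * ((R ^ κ)⁻¹ ^ k * (R ^ n * ω * R ^ κ * v))
            + K * (R⁻¹ ^ m * (R ^ n * ω * R ^ κ * v ^ p)))) := by
        gcongr
        refine (hest a f u0 u hst hsol R hR).trans ?_
        gcongr
    _ = v + R⁻¹ ^ m * (R ^ κ) ^ k * v ^ p := by
        simp only [inv_pow]
        field_simp
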